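/- Let P and Q be two finite presentations of the same group G, and let α, β ≥ 1 be real numbers. If (n^α, n^β) is an (Area, FL)-pair for P, then (n^α, n^β) is also an (Area, FL)-pair for Q. -/

import Mathlib

/-- A word over the alphabet `A`: a list of letters `(a, b)`, where the boolean `b`
records whether the letter is the generator `a` (when `true`) or its formal
inverse `a⁻¹` (when `false`). -/
abbrev Word (A : Type) := List (A × Bool)

/-- The formal inverse of a word. -/
def wordInv {A : Type} (w : Word A) : Word A := (w.map (fun p => (p.1, !p.2))).reverse

/-- `IsCyclicConj v w` : the word `v` is a cyclic conjugate of the word `w`. -/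
def IsCyclicConj {A : Type} (v w : Word A) : Prop := ∃ p q, w = p ++ q ∧ v = q ++ p

/-- A free reduction (deleting a subword `a a⁻¹`, `a` a generator or an inverse of a
generator) or a free expansion (inserting such a subword). -/
def FreeStep {A : Type} (w w' : Word A) : Prop :=
  (∃ (α β : Word A) (x : A × Bool), w = α ++ [x, (x.1, !x.2)] ++ β ∧ w' = α ++ β) ∨
  (∃ (α β : Word A) (x : A × Bool), w = α ++ β ∧ w' = α ++ [x, (x.1, !x.2)] ++ β)

/-- An application of a relator from `R`: replace `w = αuβ` by `w' = αvβ` where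
`u v⁻¹` is a cyclic conjugate of an element of `R` or of the inverse of an element
of `R`. -/
def RelStep {A : Type} (R : Set (Word A)) (w w' : Word A) : Prop :=
  ∃ (α u v β : Word A), w = α ++ u ++ β ∧ w' = α ++ v ++ β ∧
    ∃ r ∈ R, IsCyclicConj (u ++ wordInv v) r ∨ IsCyclicConj (u ++ wordInv v) (wordInv r)

/-- A `P`-sequence for the presentation with relator set `R` : a finite sequence of
words `seq 0, seq 1, …, seq len`, each obtained from the previous one by a free
reduction, a free expansion, or an application of a relator.  The field `isRel`
records which steps are applications of relators. -/
structure PSeq {A : Type} (R : Set (Word A)) where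
  len : ℕ
  seq : Fin (len + 1) → Word A
  isRel : Fin len → Bool
  step : ∀ i : Fin len,
    if isRel i then RelStep R (seq i.castSucc) (seq i.succ)
    else FreeStep (seq i.castSucc) (seq i.succ)

/-- The area of a `P`-sequence: the number of application-of-a-relator moves. -/
def PSeq.area {A : Type} {R : Set (Word A)} (S : PSeq R) : ℕ :=
  (Finset.univ.filter (fun i => S.isRel i = true)).card

/-- The filling length of a `P`-sequence: the maximum of the lengths of its words. -/
def PSeq.fl {A : Type} {R : Set (Word A)} (S : PSeq R) : ℕ :=
  Finset.univ.sup (fun i => (S.seq i).length)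

/-- The height of a `P`-sequence: its number of moves. -/
def PSeq.height {A : Type} {R : Set (Word A)} (S : PSeq R) : ℕ := S.len

/-- `S` is a null-`P`-sequence for the word `w`: it starts at `w` and ends at the
empty word. -/
def IsNullSeq {A : Type} {R : Set (Word A)} (S : PSeq R) (w : Word A) : Prop :=
  S.seq 0 = w ∧ S.seq (Fin.last S.len) = []

/-- `Derives R L n w w'` : the word `w` can be transformed into `w'` by free moves and at most `n`
applications of relators from `R`, through words of length at most `L`. -/
inductive Derives {A : Type} (R : Set (Word A)) (L : ℕ) : ℕ → Word A → Word A → Prop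
  | refl (n : ℕ) (w : Word A) (hw : w.length ≤ L) : Derives R L n w w
  | free {n : ℕ} {w w' w'' : Word A} (hw : w.length ≤ L) (hs : FreeStep w w')
      (h : Derives R L n w' w'') : Derives R L n w w''
  | rel {n : ℕ} {w w' w'' : Word A} (hw : w.length ≤ L) (hs : RelStep R w w')
      (h : Derives R L n w' w'') : Derives R L (n + 1) w w''

theorem mk_wordInv {A : Type} (w : Word A) : FreeGroup.mk (wordInv w) = (FreeGroup.mk w)⁻¹ :=
  FreeGroup.inv_mk.symm

theorem length_wordInv {A : Type} (w : Word A) : (wordInv w).length = w.length := by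
  simp [wordInv]

theorem wordInv_wordInv {A : Type} (w : Word A) : wordInv (wordInv w) = w :=
  FreeGroup.invRev_invRev

theorem wordInv_append {A : Type} (u v : Word A) :
    wordInv (u ++ v) = wordInv v ++ wordInv u := by
  simp [wordInv]

theorem IsCyclicConj.wordInv {A : Type} {v w : Word A} (h : IsCyclicConj v w) :
    IsCyclicConj (wordInv v) (wordInv w) := by
  obtain ⟨p, q, rfl, rfl⟩ := h
  exact ⟨_, _, wordInv_append _ _, wordInv_append _ _⟩

theorem IsCyclicConj.length_eq {A : Type} {v w : Word A} (h : IsCyclicConj v w) :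
    v.length = w.length := by
  obtain ⟨p, q, rfl, rfl⟩ := h
  simp [add_comm]

theorem IsCyclicConj.map_eq_one {A G : Type} [Group G] (π : FreeGroup A →* G) {v w : Word A}
    (h : IsCyclicConj v w) (hw : π (FreeGroup.mk w) = 1) : π (FreeGroup.mk v) = 1 := by
  obtain ⟨p, q, rfl, rfl⟩ := h
  rw [← FreeGroup.mul_mk, map_mul] at hw ⊢
  exact mul_eq_one_comm.mp hw

theorem FreeStep.symm {A : Type} {w w' : Word A} (h : FreeStep w w') : FreeStep w' w := by
  rcases h with ⟨a, b, x, h₁, h₂⟩ | ⟨a, b, x, h₁, h₂⟩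
  · exact Or.inr ⟨a, b, x, h₂, h₁⟩
  · exact Or.inl ⟨a, b, x, h₂, h₁⟩

theorem FreeStep.append {A : Type} {w w' : Word A} (h : FreeStep w w') (p q : Word A) :
    FreeStep (p ++ w ++ q) (p ++ w' ++ q) := by
  rcases h with ⟨a, b, x, rfl, rfl⟩ | ⟨a, b, x, rfl, rfl⟩
  · exact Or.inl ⟨p ++ a, b ++ q, x, by simp, by simp⟩
  · exact Or.inr ⟨p ++ a, b ++ q, x, by simp, by simp⟩

theorem RelStep.symm {A : Type} {R : Set (Word A)} {w w' : Word A} (h : RelStep R w w') :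
    RelStep R w' w := by
  obtain ⟨a, u, v, b, h₁, h₂, r, hr, h⟩ := h
  have key : wordInv (u ++ wordInv v) = v ++ wordInv u := by
    rw [wordInv_append, wordInv_wordInv]
  refine ⟨a, v, u, b, h₂, h₁, r, hr, ?_⟩
  rw [← key]
  rcases h with h | h
  · exact Or.inr h.wordInv
  · exact Or.inl (by simpa only [wordInv_wordInv] using h.wordInv)

theorem RelStep.append {A : Type} {R : Set (Word A)} {w w' : Word A} (h : RelStep R w w')
    (p q : Word A) : RelStep R (p ++ w ++ q) (p ++ w' ++ q) := by
  obtain ⟨a, u, v, b, rfl, rfl, h⟩ := h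
  exact ⟨p ++ a, u, v, b ++ q, by simp, by simp, h⟩

namespace Derives

variable {A : Type} {R : Set (Word A)} {L L' n m : ℕ} {u v w : Word A}

theorem length_left (h : Derives R L n u v) : u.length ≤ L := by
  cases h <;> assumption

theorem length_right (h : Derives R L n u v) : v.length ≤ L := by
  induction h <;> assumption

theorem mono (h : Derives R L n u v) (hL : L ≤ L') (hn : n ≤ m) : Derives R L' m u v := by
  induction h generalizing m with
  | refl n w hw => exact refl _ _ (hw.trans hL)
  | free hw hs _ ih => exact free (hw.trans hL) hs (ih hn)
  | rel hw hs _ ih =>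
    obtain ⟨k, rfl⟩ : ∃ k, m = k + 1 := ⟨m - 1, by omega⟩
    exact rel (hw.trans hL) hs (ih (by omega))

theorem trans (h : Derives R L n u v) (h' : Derives R L m v w) : Derives R L (n + m) u w := by
  induction h with
  | refl n w hw => exact h'.mono le_rfl (by omega)
  | free hw hs _ ih => exact free hw hs (ih h')
  | rel hw hs _ ih => exact (rel hw hs (ih h')).mono le_rfl (by omega)

theorem symm (h : Derives R L n u v) : Derives R L n v u := by
  induction h with
  | refl n w hw => exact refl _ _ hw
  | free hw hs _ ih => exact ih.trans (free (n := 0) ih.length_right hs.symm (refl _ _ hw))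
  | rel hw hs _ ih => exact ih.trans (rel (n := 0) ih.length_right hs.symm (refl _ _ hw))

theorem append (h : Derives R L n u v) (p q : Word A) (hL : L + p.length + q.length ≤ L') :
    Derives R L' n (p ++ u ++ q) (p ++ v ++ q) := by
  have hlen : ∀ w : Word A, w.length ≤ L → (p ++ w ++ q).length ≤ L' := fun w hw => by
    simp only [List.length_append]
    omega
  induction h with
  | refl n w hw => exact refl _ _ (hlen _ hw)
  | free hw hs _ ih => exact free (hlen _ hw) (hs.append p q) ih
  | rel hw hs _ ih => exact rel (hlen _ hw) (hs.append p q) ih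

theorem exists_pSeq (h : Derives R L n u v) :
    ∃ S : PSeq R, S.seq 0 = u ∧ S.seq (Fin.last S.len) = v ∧ S.area ≤ n ∧ S.fl ≤ L := by
  have cons : ∀ (c : Bool) (w w' w'' : Word A) (n : ℕ), w.length ≤ L →
      (if c then RelStep R w w' else FreeStep w w') →
      (∃ S : PSeq R, S.seq 0 = w' ∧ S.seq (Fin.last S.len) = w'' ∧ S.area ≤ n ∧ S.fl ≤ L) →
      ∃ S : PSeq R, S.seq 0 = w ∧ S.seq (Fin.last S.len) = w'' ∧
        S.area ≤ n + (if c then 1 else 0) ∧ S.fl ≤ L := by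
    rintro c w w' w'' n hw hc ⟨S, rfl, rfl, hn, hL⟩
    refine ⟨⟨S.len + 1, Fin.cons w S.seq, Fin.cons c S.isRel, fun i => ?_⟩, ?_, ?_, ?_, ?_⟩
    · refine Fin.cases ?_ (fun j => ?_) i
      · simpa using hc
      · simpa only [Fin.cons_succ, Fin.castSucc_succ] using S.step j
    · rfl
    · rfl
    · simp only [PSeq.area] at hn ⊢
      rw [Fin.card_filter_univ_succ]
      simp only [Fin.cons_zero, Fin.cons_succ]
      split_ifs <;> omega
    · simp only [PSeq.fl, Finset.sup_le_iff, Finset.mem_univ, true_imp_iff] at hL ⊢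
      exact Fin.cases hw hL
  induction h with
  | refl n w hw =>
    exact ⟨⟨0, fun _ => w, fun _ => false, fun i => i.elim0⟩, rfl, rfl,
      by simp [PSeq.area], by simpa [PSeq.fl] using hw⟩
  | free hw hs _ ih => exact cons false _ _ _ _ hw (by simpa using hs) ih
  | rel hw hs _ ih => exact cons true _ _ _ _ hw (by simpa using hs) ih

end Derives

theorem PSeq.derives {A : Type} {R : Set (Word A)} (S : PSeq R) :
    Derives R S.fl S.area (S.seq 0) (S.seq (Fin.last S.len)) := by
  obtain ⟨k, seq, isRel, step⟩ := S
  induction k with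
  | zero =>
    exact .refl _ _ (Finset.le_sup (f := fun i => (seq i).length) (Finset.mem_univ _))
  | succ k ih =>
    have tail := ih (fun i => seq i.succ) (fun i => isRel i.succ) (fun i => step i.succ)
    have hfl : ∀ i, (seq i).length ≤ PSeq.fl ⟨k + 1, seq, isRel, step⟩ := fun i =>
      Finset.le_sup (f := fun i => (seq i).length) (Finset.mem_univ i)
    replace tail := tail.mono (L' := PSeq.fl ⟨k + 1, seq, isRel, step⟩)
      (Finset.sup_le fun i _ => hfl i.succ) le_rfl
    have h0 := step 0
    simp only [PSeq.area] at tail ⊢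
    rw [Fin.card_filter_univ_succ]
    split_ifs at h0 ⊢ with h
    · exact .rel (hfl _) h0 tail
    · exact .free (hfl _) h0 tail

theorem exists_derives_of_mk_eq {A : Type} (R : Set (Word A)) {u v : Word A}
    (h : FreeGroup.mk u = FreeGroup.mk v) : ∃ L, Derives R L 0 u v := by
  have red : ∀ {u v : Word A}, FreeGroup.Red u v → ∃ L, Derives R L 0 u v := by
    intro u v h
    induction h using Relation.ReflTransGen.head_induction_on with
    | refl => exact ⟨_, .refl _ _ le_rfl⟩
    | @head a c hs _ ih =>
      obtain ⟨L, hL⟩ := ih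
      refine ⟨max a.length L, .free (le_max_left _ _) ?_ (hL.mono (le_max_right _ _) le_rfl)⟩
      obtain ⟨⟩ := hs
      exact Or.inl ⟨_, _, (_, _), (List.append_assoc _ [_, _] _).symm, rfl⟩
  obtain ⟨c, hu, hv⟩ := FreeGroup.Red.exact.mp h
  obtain ⟨L₁, h₁⟩ := red hu
  obtain ⟨L₂, h₂⟩ := red hv
  exact ⟨max L₁ L₂, (h₁.mono (le_max_left _ _) le_rfl).trans
    (h₂.symm.mono (le_max_right _ _) le_rfl)⟩

theorem exists_derives_nil {A : Type} (R : Set (Word A)) {g : FreeGroup A}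
    (hg : g ∈ Subgroup.normalClosure (FreeGroup.mk '' R)) :
    ∀ w : Word A, FreeGroup.mk w = g → ∃ L n, Derives R L n w [] := by
  have comp : ∀ {u v w : Word A}, (∃ L n, Derives R L n u v) → (∃ L n, Derives R L n v w) →
      ∃ L n, Derives R L n u w := by
    rintro u v w ⟨L₁, n₁, h₁⟩ ⟨L₂, n₂, h₂⟩
    exact ⟨max L₁ L₂, _, (h₁.mono (le_max_left _ _) le_rfl).trans
      (h₂.mono (le_max_right _ _) le_rfl)⟩
  have ofMk : ∀ {u v : Word A}, FreeGroup.mk u = FreeGroup.mk v →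
      ∃ L n, Derives R L n u v := fun h =>
    (exists_derives_of_mk_eq R h).imp fun _ h => ⟨0, h⟩
  have ctx : ∀ {u v : Word A} (p q : Word A), (∃ L n, Derives R L n u v) →
      ∃ L n, Derives R L n (p ++ u ++ q) (p ++ v ++ q) := fun p q ⟨L, n, h⟩ =>
    ⟨_, _, h.append p q le_rfl⟩
  induction hg using Subgroup.closure_induction with
  | mem x hx =>
    intro w hw
    obtain ⟨_, ⟨r, hr, rfl⟩, hc⟩ := Group.mem_conjugatesOfSet_iff.mp hx
    obtain ⟨c, rfl⟩ := isConj_iff.mp hc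
    obtain ⟨c, rfl⟩ := Quot.exists_rep c
    have hr' : ∃ L n, Derives R L n r [] :=
      ⟨r.length, 1, .rel le_rfl ⟨[], r, [], [], by simp, by simp, r, hr,
        Or.inl ⟨[], r, by simp, by simp [wordInv]⟩⟩ (.refl 0 _ (by simp))⟩
    refine comp (ofMk (v := c ++ r ++ wordInv c) ?_) (comp (ctx c (wordInv c) hr') (ofMk ?_))
    · rw [hw, ← FreeGroup.mul_mk, ← FreeGroup.mul_mk, mk_wordInv]
      rfl
    · rw [List.append_nil, ← FreeGroup.mul_mk, mk_wordInv, mul_inv_cancel, FreeGroup.one_eq_mk]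
  | one =>
    intro w hw
    exact ofMk (hw.trans FreeGroup.one_eq_mk)
  | mul x y _ _ hx hy =>
    intro w hw
    obtain ⟨x, rfl⟩ := Quot.exists_rep x
    obtain ⟨y, rfl⟩ := Quot.exists_rep y
    refine comp (ofMk (v := x ++ y) (hw.trans ?_)) (comp ?_ (hy y rfl))
    · rw [← FreeGroup.mul_mk]
      rfl
    · simpa using ctx [] y (hx x rfl)
  | inv x _ hx =>
    intro w hw
    have hw' : FreeGroup.mk (wordInv w) = x := by rw [mk_wordInv, hw, inv_inv]
    obtain ⟨L, n, h⟩ := hx _ hw'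
    have h' : ∃ L n, Derives R L n w (w ++ wordInv w) := by
      simpa using ctx w [] ⟨L, n, h.symm⟩
    refine comp h' (ofMk ?_)
    rw [← FreeGroup.mul_mk, mk_wordInv, mul_inv_cancel, FreeGroup.one_eq_mk]

theorem exists_derives {A G : Type} [Group G] {R : Set (Word A)} {π : FreeGroup A →* G}
    (hker : π.ker = Subgroup.normalClosure (FreeGroup.mk '' R)) {u v : Word A}
    (h : π (FreeGroup.mk u) = π (FreeGroup.mk v)) : ∃ L n, Derives R L n u v := by
  have hmem : FreeGroup.mk (u ++ wordInv v) ∈ Subgroup.normalClosure (FreeGroup.mk '' R) := by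
    rw [← hker, MonoidHom.mem_ker, ← FreeGroup.mul_mk, mk_wordInv, map_mul, map_inv, h,
      mul_inv_cancel]
  obtain ⟨L₁, n₁, h₁⟩ := exists_derives_nil R hmem _ rfl
  obtain ⟨L₂, h₂⟩ := exists_derives_of_mk_eq R (u := u) (v := u ++ wordInv v ++ v) (by
    rw [← FreeGroup.mul_mk, ← FreeGroup.mul_mk, mk_wordInv, inv_mul_cancel_right])
  have h₃ := h₁.append [] v le_rfl
  exact ⟨_, _, (h₂.mono (le_max_left _ _) le_rfl).trans (h₃.mono (le_max_right _ _) le_rfl)⟩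

/-- The word obtained from `w` by substituting the word `f a` for each generator `a`. -/
def wordSubst {A B : Type} (f : A → Word B) (w : Word A) : Word B :=
  w.flatMap fun p => if p.2 then f p.1 else wordInv (f p.1)

theorem wordSubst_append {A B : Type} (f : A → Word B) (u v : Word A) :
    wordSubst f (u ++ v) = wordSubst f u ++ wordSubst f v :=
  List.flatMap_append

theorem wordSubst_cons {A B : Type} (f : A → Word B) (x : A × Bool) (w : Word A) :
    wordSubst f (x :: w) = wordSubst f [x] ++ wordSubst f w :=
  wordSubst_append f [x] w

theorem map_mk_wordSubst {A B G : Type} [Group G] {π : FreeGroup A →* G} {ρ : FreeGroup B →* G}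
    {f : A → Word B} (hf : ∀ a, ρ (FreeGroup.mk (f a)) = π (FreeGroup.of a)) (w : Word A) :
    ρ (FreeGroup.mk (wordSubst f w)) = π (FreeGroup.mk w) := by
  induction w with
  | nil => exact (map_one ρ).trans (map_one π).symm
  | cons x w ih =>
    have hx : ρ (FreeGroup.mk (wordSubst f [x])) = π (FreeGroup.mk [x]) := by
      obtain ⟨a, _ | _⟩ := x
      · have : (FreeGroup.mk [(a, false)]) = (FreeGroup.of a)⁻¹ := rfl
        simp [wordSubst, mk_wordInv, hf, this, -FreeGroup.inv_mk]
      · exact (congrArg _ (by simp [wordSubst])).trans (hf a)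
    rw [wordSubst_cons, ← FreeGroup.mul_mk, map_mul, hx, ih, ← map_mul, FreeGroup.mul_mk,
      List.singleton_append]

theorem exists_length_wordSubst_le {A B : Type} [Finite A] (f : A → Word B) :
    ∃ C, ∀ w : Word A, (wordSubst f w).length ≤ C * w.length := by
  obtain ⟨C, hC⟩ := (Set.finite_range fun a => (f a).length).bddAbove
  refine ⟨C, fun w => ?_⟩
  induction w with
  | nil => simp [wordSubst]
  | cons x w ih =>
    have hx : (wordSubst f [x]).length ≤ C := by
      have := hC ⟨x.1, rfl⟩
      simp only [wordSubst, List.flatMap_singleton]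
      split_ifs
      · exact this
      · rwa [length_wordInv]
    rw [wordSubst_cons, List.length_append, List.length_cons, mul_add_one]
    omega

/-- A bound for derivations between boundedly many pairs of words can be chosen uniformly. -/
theorem exists_derives_of_finite {ι A : Type} {R : Set (Word A)} {s : Set ι} (hs : s.Finite)
    {u v : ι → Word A} (h : ∀ i ∈ s, ∃ L n, Derives R L n (u i) (v i)) :
    ∃ L n, ∀ i ∈ s, Derives R L n (u i) (v i) := by
  induction s, hs using Set.Finite.induction_on with
  | empty => exact ⟨0, 0, by simp⟩
  | @insert a s _ _ ih =>
    obtain ⟨L₁, n₁, h₁⟩ := h a (Set.mem_insert _ _)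
    obtain ⟨L₂, n₂, h₂⟩ := ih fun i hi => h i (Set.mem_insert_of_mem _ hi)
    refine ⟨max L₁ L₂, max n₁ n₂, ?_⟩
    rintro i (rfl | hi)
    · exact h₁.mono (le_max_left _ _) (le_max_left _ _)
    · exact (h₂ i hi).mono (le_max_right _ _) (le_max_right _ _)

theorem RelStep.exists_length_le {A G : Type} [Group G] {R : Set (Word A)} {π : FreeGroup A →* G}
    (hR : ∀ r ∈ R, π (FreeGroup.mk r) = 1) {K : ℕ} (hK : ∀ r ∈ R, r.length ≤ K) {w w' : Word A}
    (h : RelStep R w w') : ∃ p u v q, w = p ++ u ++ q ∧ w' = p ++ v ++ q ∧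
      u.length ≤ K ∧ v.length ≤ K ∧ π (FreeGroup.mk u) = π (FreeGroup.mk v) := by
  obtain ⟨p, u, v, q, h₁, h₂, r, hr, h⟩ := h
  have key : (u ++ wordInv v).length = r.length ∧ π (FreeGroup.mk (u ++ wordInv v)) = 1 := by
    rcases h with h | h
    · exact ⟨h.length_eq, h.map_eq_one π (hR r hr)⟩
    · refine ⟨h.length_eq.trans (length_wordInv r), h.map_eq_one π ?_⟩
      rw [mk_wordInv, map_inv, hR r hr, inv_one]
  obtain ⟨hlen, hone⟩ := key
  rw [List.length_append, length_wordInv] at hlen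
  rw [← FreeGroup.mul_mk, mk_wordInv, map_mul, map_inv] at hone
  have := hK r hr
  exact ⟨p, u, v, q, h₁, h₂, by omega, by omega, mul_inv_eq_one.mp hone⟩

/-- A substitution inducing the identity on `G` carries derivations over one finite presentation
to derivations over another one with linear control. -/
theorem exists_derives_wordSubst {A B G : Type} [Finite A] [Group G]
    {R : Set (Word A)} (hRfin : R.Finite) {π : FreeGroup A →* G}
    (hR : ∀ r ∈ R, π (FreeGroup.mk r) = 1) {T : Set (Word B)} {ρ : FreeGroup B →* G}
    (hkerQ : ρ.ker = Subgroup.normalClosure (FreeGroup.mk '' T))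
    {f : A → Word B} (hf : ∀ a, ρ (FreeGroup.mk (f a)) = π (FreeGroup.of a)) :
    ∃ C N, ∀ (L n : ℕ) (w w' : Word A), Derives R L n w w' →
      Derives T (C * (L + 1)) (N * n) (wordSubst f w) (wordSubst f w') := by
  obtain ⟨C, hC⟩ := exists_length_wordSubst_le f
  obtain ⟨K, hK⟩ := (hRfin.image List.length).bddAbove
  have hK' : ∀ r ∈ R, r.length ≤ K := fun r hr => hK ⟨r, hr, rfl⟩
  have hfin : {x : Word A × Word A | x.1.length ≤ K ∧ x.2.length ≤ K ∧
      π (FreeGroup.mk x.1) = π (FreeGroup.mk x.2)}.Finite :=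
    ((List.finite_length_le _ K).prod (List.finite_length_le _ K)).subset
      fun x hx => ⟨hx.1, hx.2.1⟩
  obtain ⟨L₁, N, h₁⟩ := exists_derives_of_finite (R := T) hfin
    (u := fun x => wordSubst f x.1) (v := fun x => wordSubst f x.2) fun x hx =>
      exists_derives hkerQ (by rw [map_mk_wordSubst hf, map_mk_wordSubst hf, hx.2.2])
  have hfree : ∃ L₂, ∀ x : A × Bool, Derives T L₂ 0 (wordSubst f [x, (x.1, !x.2)]) [] := by
    have : ∀ x : A × Bool, ∃ L, Derives T L 0 (wordSubst f [x, (x.1, !x.2)]) [] := by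
      rintro ⟨a, b⟩
      refine exists_derives_of_mk_eq T ?_
      cases b <;> simp [wordSubst, ← FreeGroup.mul_mk, mk_wordInv,
        ← FreeGroup.one_eq_mk, -FreeGroup.inv_mk]
    choose L hL using this
    obtain ⟨L₂, h₂⟩ := (Set.finite_range L).bddAbove
    exact ⟨L₂, fun x => (hL x).mono (h₂ ⟨x, rfl⟩) le_rfl⟩
  obtain ⟨L₂, h₂⟩ := hfree
  have bound : ∀ {L : ℕ} (p q : Word A), p.length + q.length ≤ L →
      (wordSubst f p).length + (wordSubst f q).length ≤ C * L := fun p q h =>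
    (add_le_add (hC p) (hC q)).trans (by rw [← mul_add]; exact Nat.mul_le_mul_left _ h)
  refine ⟨C + L₁ + L₂, N, fun L n w w' h => ?_⟩
  have hB : C * L + L₁ + L₂ ≤ (C + L₁ + L₂) * (L + 1) := by
    nlinarith [Nat.zero_le (L₁ * L), Nat.zero_le (L₂ * L)]
  have hword : ∀ {w : Word A}, w.length ≤ L →
      (wordSubst f w).length ≤ (C + L₁ + L₂) * (L + 1) := fun {w} hw => by
    have := (hC w).trans (Nat.mul_le_mul_left _ hw)
    omega
  have cancel : ∀ (p q : Word A) (x : A × Bool), (p ++ [x, (x.1, !x.2)] ++ q).length ≤ L →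
      Derives T ((C + L₁ + L₂) * (L + 1)) 0 (wordSubst f (p ++ [x, (x.1, !x.2)] ++ q))
        (wordSubst f (p ++ q)) := by
    intro p q x hlen
    simp only [List.length_append] at hlen
    have := bound (L := L) p q (by omega)
    simp only [wordSubst_append]
    simpa using (h₂ x).append (L' := (C + L₁ + L₂) * (L + 1)) (wordSubst f p) (wordSubst f q)
      (by omega)
  induction h with
  | refl n w hw => exact .refl _ _ (hword hw)
  | free hw hs h ih =>
    have hw' := h.length_left
    rw [← Nat.zero_add (N * _)]
    refine Derives.trans ?_ ih
    rcases hs with ⟨p, q, x, rfl, rfl⟩ | ⟨p, q, x, rfl, rfl⟩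
    · exact cancel p q x hw
    · exact (cancel p q x hw').symm
  | rel hw hs h ih =>
    rw [Nat.mul_succ N, Nat.add_comm (N * _)]
    refine Derives.trans ?_ ih
    obtain ⟨p, u, v, q, rfl, rfl, hu, hv, huv⟩ := hs.exists_length_le hR hK'
    simp only [List.length_append] at hw
    have := bound (L := L) p q (by omega)
    simp only [wordSubst_append]
    exact (h₁ (u, v) ⟨hu, hv, huv⟩).append _ _ (by omega)

/-- Rewriting every letter by an equivalent word costs linear area and linear filling length. -/
theorem exists_derives_letterwise {A G : Type} [Finite A] [Group G] {R : Set (Word A)}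
    {π : FreeGroup A →* G} (hker : π.ker = Subgroup.normalClosure (FreeGroup.mk '' R))
    {F : Word A → Word A} (hF : ∀ u v, F (u ++ v) = F u ++ F v)
    (hFπ : ∀ w, π (FreeGroup.mk (F w)) = π (FreeGroup.mk w)) :
    ∃ C N, ∀ w : Word A, Derives R (C * (w.length + 1)) (N * w.length) w (F w) := by
  obtain ⟨L, N, h⟩ := exists_derives_of_finite (R := R) (Set.finite_univ (α := A × Bool))
    (u := fun x => [x]) (v := fun x => F [x]) fun x _ => exists_derives hker (hFπ [x]).symm
  have hnil : F [] = [] := by simpa using hF [] []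
  refine ⟨L + 1, N, fun w => ?_⟩
  induction w with
  | nil => simpa [hnil] using Derives.refl 0 ([] : Word A) (Nat.zero_le _)
  | cons x w ih =>
    have hx := h x (Set.mem_univ x)
    have hFx := hx.length_right
    have h₁ := hx.append (L' := (L + 1) * ((x :: w).length + 1)) [] w (by
      simp only [List.length_nil, List.length_cons]
      nlinarith [Nat.zero_le (L * w.length)])
    have h₂ := ih.append (L' := (L + 1) * ((x :: w).length + 1)) (F [x]) [] (by
      simp only [List.length_nil, List.length_cons]
      nlinarith)
    have hcons : F (x :: w) = F [x] ++ F w := hF [x] w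
    rw [hcons]
    simp only [List.append_nil, List.nil_append] at h₁ h₂
    exact (h₁.trans h₂).mono le_rfl (by rw [List.length_cons, mul_add_one, add_comm])

theorem exists_word_lift {A B G : Type} [Group G] (π : FreeGroup A →* G) {ρ : FreeGroup B →* G}
    (hρ : Function.Surjective ρ) :
    ∃ f : A → Word B, ∀ a, ρ (FreeGroup.mk (f a)) = π (FreeGroup.of a) := by
  have : ∀ a, ∃ w, ρ (FreeGroup.mk w) = π (FreeGroup.of a) := fun a => by
    obtain ⟨g, hg⟩ := hρ (π (FreeGroup.of a))
    obtain ⟨w, rfl⟩ := Quot.exists_rep g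
    exact ⟨w, hg⟩
  exact ⟨fun a => (this a).choose, fun a => (this a).choose_spec⟩

/-- **Lemma (invariance of power `(Area, FL)`-pairs).**  Let `P = ⟨A ∣ R⟩` and
`Q = ⟨B ∣ T⟩ ` be two finite presentations of the same group `G` and let
`α, β ≥ 1` be reals.  If `(n^α, n^β)` is an `(Area, FL)`-pair for `P` then it is
also an `(Area, FL)`-pair for `Q`. -/
theorem area_fl_pair_invariance
    {A B : Type} [Fintype A] [Fintype B] {G : Type} [Group G]
    (R : Finset (Word A)) (π : FreeGroup A →* G)
    (hsurjP : Function.Surjective π)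
    (hkerP : π.ker = Subgroup.normalClosure (FreeGroup.mk '' (R : Set (Word A))))
    (T : Finset (Word B)) (ρ : FreeGroup B →* G)
    (hsurjQ : Function.Surjective ρ)
    (hkerQ : ρ.ker = Subgroup.normalClosure (FreeGroup.mk '' (T : Set (Word B))))
    (α β : ℝ) (hα : 1 ≤ α) (hβ : 1 ≤ β)
    (hP : ∃ lam : ℝ, 0 < lam ∧ ∀ w : Word A, π (FreeGroup.mk w) = 1 →
      ∃ S : PSeq (R : Set (Word A)), IsNullSeq S w ∧
        (S.area : ℝ) ≤ lam * (w.length : ℝ) ^ α ∧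
        (S.fl : ℝ) ≤ lam * (w.length : ℝ) ^ β) :
    ∃ lam : ℝ, 0 < lam ∧ ∀ w : Word B, ρ (FreeGroup.mk w) = 1 →
      ∃ S : PSeq (T : Set (Word B)), IsNullSeq S w ∧
        (S.area : ℝ) ≤ lam * (w.length : ℝ) ^ α ∧
        (S.fl : ℝ) ≤ lam * (w.length : ℝ) ^ β := by
  obtain ⟨lam, hlam, hP⟩ := hP
  obtain ⟨f, hf⟩ := exists_word_lift π hsurjQ
  obtain ⟨g, hg⟩ := exists_word_lift ρ hsurjP
  have hR : ∀ r ∈ (R : Set (Word A)), π (FreeGroup.mk r) = 1 := fun r hr => by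
    rw [← MonoidHom.mem_ker, hkerP]
    exact Subgroup.subset_normalClosure ⟨r, hr, rfl⟩
  obtain ⟨C, N, hsubst⟩ := exists_derives_wordSubst R.finite_toSet hR hkerQ hf
  obtain ⟨D, M, hletter⟩ := exists_derives_letterwise hkerQ
    (F := fun w => wordSubst f (wordSubst g w))
    (fun u v => by simp only [wordSubst_append])
    (fun w => by rw [map_mk_wordSubst hf, map_mk_wordSubst hg])
  obtain ⟨E, hE⟩ := exists_length_wordSubst_le g
  refine ⟨1 + (M + N * (lam * E ^ α)) + (2 * D + C * (lam * E ^ β + 1)), by positivity,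
    fun w hw => ?_⟩
  rcases Nat.eq_zero_or_pos w.length with h0 | hpos
  · obtain rfl := List.length_eq_zero_iff.mp h0
    refine ⟨⟨0, fun _ => [], fun _ => false, fun i => i.elim0⟩, ⟨rfl, rfl⟩, ?_, ?_⟩
    · simp [PSeq.area, Real.zero_rpow (by linarith : α ≠ 0)]
    · simp [PSeq.fl, Real.zero_rpow (by linarith : β ≠ 0)]
  obtain ⟨S, ⟨hS0, hS1⟩, harea, hfl⟩ := hP (wordSubst g w) (by rw [map_mk_wordSubst hg, hw])
  have hS := hsubst _ _ _ _ S.derives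
  rw [hS0, hS1] at hS
  obtain ⟨U, hU0, hU1, hUarea, hUfl⟩ :=
    (((hletter w).mono (le_max_left _ (C * (S.fl + 1))) le_rfl).trans
      (hS.mono (le_max_right _ _) le_rfl)).exists_pSeq
  have hn : (1 : ℝ) ≤ w.length := by exact_mod_cast hpos
  have hpow : ∀ {γ : ℝ}, 1 ≤ γ → (w.length : ℝ) ≤ (w.length : ℝ) ^ γ ∧
      ((wordSubst g w).length : ℝ) ^ γ ≤ E ^ γ * (w.length : ℝ) ^ γ := fun {γ} hγ => by
    refine ⟨Real.self_le_rpow_of_one_le hn hγ, ?_⟩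
    rw [← Real.mul_rpow (by positivity) (by positivity)]
    exact Real.rpow_le_rpow (by positivity) (by exact_mod_cast hE w) (by linarith)
  refine ⟨U, ⟨hU0, hU1⟩, ?_, ?_⟩
  · obtain ⟨h₁, h₂⟩ := hpow hα
    have hU : (U.area : ℝ) ≤ M * w.length + N * S.area := by exact_mod_cast hUarea
    calc (U.area : ℝ) ≤ M * w.length + N * S.area := hU
      _ ≤ M * (w.length : ℝ) ^ α + N * (lam * (E ^ α * (w.length : ℝ) ^ α)) := by
          gcongr
          exact harea.trans (by gcongr)
      _ = (M + N * (lam * E ^ α)) * (w.length : ℝ) ^ α := by ring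
      _ ≤ _ := by
          refine mul_le_mul_of_nonneg_right ?_ (by positivity)
          have : 0 ≤ 2 * (D : ℝ) + C * (lam * E ^ β + 1) := by positivity
          linarith
  · obtain ⟨h₁, h₂⟩ := hpow hβ
    have hU : (U.fl : ℝ) ≤ D * (w.length + 1) + C * (S.fl + 1) := by
      exact_mod_cast hUfl.trans (max_le (Nat.le_add_right _ _) (Nat.le_add_left _ _))
    calc (U.fl : ℝ) ≤ D * (w.length + 1) + C * (S.fl + 1) := hU
      _ ≤ D * ((w.length : ℝ) ^ β + (w.length : ℝ) ^ β) +
          C * (lam * (E ^ β * (w.length : ℝ) ^ β) + (w.length : ℝ) ^ β) := by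
          gcongr
          · exact hn.trans h₁
          · exact hfl.trans (by gcongr)
          · exact hn.trans h₁
      _ = (2 * D + C * (lam * E ^ β + 1)) * (w.length : ℝ) ^ β := by ring
      _ ≤ _ := by
          refine mul_le_mul_of_nonneg_right ?_ (by positivity)
          have : 0 ≤ (M : ℝ) + N * (lam * E ^ α) := by positivity
          linarith
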